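/- arXiv:1902.06353 — 2 statements merged into one kernel-verified Lean document; each statement's English description precedes it below -/
import Mathlib

section
/- Let N ≤ K be positive integers and Δ_min > 0. Let Q be an N×K real matrix whose every entry is an integer multiple of Δ_min. Let Δ be a real with 0 ≤ Δ < 3Δ_min/(8N), and let Q' be an N×K matrix such that Q'(n,i) = Q(n,i) + z(n,i) + u(n,i) for all n,i, where |z(n,i)| ≤ Δ and |u(n,i)| ≤ Δ_min/(8N). Then every assignment that maximizes the value Σ_{n=1}^N Q'(n,a(n)) over all assignments also maximizes Σ_{n=1}^N Q(n,a(n)) over all assignments. -/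
/-- Two integer multiples of `d > 0` which compare strictly up to an error `d` compare exactly. -/
theorem le_of_lt_add_of_int_multiples {x y d : ℝ} (hd : 0 < d)
    (hx : ∃ m : ℤ, x = m * d) (hy : ∃ m : ℤ, y = m * d) (h : x < y + d) : x ≤ y := by
  obtain ⟨k, rfl⟩ := hx
  obtain ⟨l, rfl⟩ := hy
  have hlt : (k : ℝ) < l + 1 := by
    refine lt_of_mul_lt_mul_right ?_ hd.le
    linarith
  have hle : k ≤ l := Int.lt_add_one_iff.mp (by exact_mod_cast hlt)
  exact mul_le_mul_of_nonneg_right (by exact_mod_cast hle) hd.le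

theorem exists_sum_eq_int_mul {ι : Type*} (s : Finset ι) {f : ι → ℝ} {d : ℝ}
    (hf : ∀ i, ∃ m : ℤ, f i = m * d) : ∃ m : ℤ, ∑ i ∈ s, f i = m * d := by
  choose m hm using hf
  exact ⟨∑ i ∈ s, m i, by simp [hm, Finset.sum_mul]⟩

/-- If every entry of `Q` is an integer multiple of `Δmin > 0`, and
`Q'` is a perturbation of `Q` by `z + u` with `|z n i| ≤ Δ < 3Δmin/(8N)` and
`|u n i| ≤ Δmin/(8N)`, then every assignment (injective map from users to channels)
maximizing the value under `Q'` also maximizes the value under `Q`. -/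
theorem stmt_0 (N K : ℕ) (hN : 0 < N) (hNK : N ≤ K)
    (Δmin : ℝ) (hΔmin : 0 < Δmin)
    (Q : Fin N → Fin K → ℝ) (hQ : ∀ n i, ∃ m : ℤ, Q n i = m * Δmin)
    (Δ : ℝ) (hΔ0 : 0 ≤ Δ) (hΔ : Δ < 3 * Δmin / (8 * N))
    (z u Q' : Fin N → Fin K → ℝ)
    (hz : ∀ n i, |z n i| ≤ Δ) (hu : ∀ n i, |u n i| ≤ Δmin / (8 * N))
    (hQ' : ∀ n i, Q' n i = Q n i + z n i + u n i)
    (a : Fin N → Fin K) (ha : Function.Injective a)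
    (hmax' : ∀ b : Fin N → Fin K, Function.Injective b →
      ∑ n, Q' n (b n) ≤ ∑ n, Q' n (a n)) :
    ∀ b : Fin N → Fin K, Function.Injective b →
      ∑ n, Q n (b n) ≤ ∑ n, Q n (a n) := by
  intro b hb
  have hN' : (0 : ℝ) < N := by exact_mod_cast hN
  have herr (c : Fin N → Fin K) : |∑ n, Q' n (c n) - ∑ n, Q n (c n)| < Δmin / 2 := by
    rw [← Finset.sum_sub_distrib]
    calc |∑ n, (Q' n (c n) - Q n (c n))|
        ≤ ∑ n, |Q' n (c n) - Q n (c n)| := Finset.abs_sum_le_sum_abs _ _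
      _ ≤ ∑ _n : Fin N, (Δ + Δmin / (8 * N)) := by
          refine Finset.sum_le_sum fun n _ => ?_
          rw [hQ', add_assoc, add_sub_cancel_left]
          exact (abs_add_le _ _).trans (add_le_add (hz _ _) (hu _ _))
      _ = N * (Δ + Δmin / (8 * N)) := by simp [mul_add]
      _ < N * (3 * Δmin / (8 * N) + Δmin / (8 * N)) := by gcongr
      _ = Δmin / 2 := by field_simp; norm_num
  refine le_of_lt_add_of_int_multiples hΔmin
    (exists_sum_eq_int_mul _ fun n => hQ n (b n)) (exists_sum_eq_int_mul _ fun n => hQ n (a n)) ?_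
  linarith [(abs_lt.mp (herr b)).1, (abs_lt.mp (herr a)).2, hmax' b hb]
end

section
/- Let N ≤ K be positive integers and Δ_min > 0. Let Q be an N×K real matrix whose every entry is an integer multiple of Δ_min. Let Δ ≥ 0 and let Q' satisfy |Q'(n,i) − Q(n,i)| ≤ Δ + Δ_min/(8N) for all n,i. Let a* be an assignment maximizing Σ_{n=1}^N Q(n,a(n)) over assignments, and let a be any assignment with Σ_{n=1}^N Q(n,a(n)) < Σ_{n=1}^N Q(n,a*(n)). Then Σ_{n=1}^N Q'(n,a*(n)) − Σ_{n=1}^N Q'(n,a(n)) ≥ 3Δ_min/4 − 2NΔ. In particular, if Δ < 3Δ_min/(8N), this difference is strictly positive. -/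
/-- A finite sum of integer multiples of `d` is an integer multiple of `d`. -/
theorem sum_int_multiple {ι : Type*} [Fintype ι] {d : ℝ} {f : ι → ℝ}
    (hf : ∀ i, ∃ m : ℤ, f i = m * d) : ∃ m : ℤ, ∑ i, f i = m * d := by
  choose m hm using hf
  exact ⟨∑ i, m i, by simp [hm, Finset.sum_mul]⟩

/-- Distinct integer multiples of `d > 0` differ by at least `d`. -/
theorem le_sub_of_lt_of_int_multiples {d x y : ℝ} (hd : 0 < d)
    (hx : ∃ m : ℤ, x = m * d) (hy : ∃ m : ℤ, y = m * d) (hxy : x < y) : d ≤ y - x := by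
  obtain ⟨k, rfl⟩ := hx
  obtain ⟨l, rfl⟩ := hy
  have hkl : k + 1 ≤ l := by exact_mod_cast lt_of_mul_lt_mul_right hxy hd.le
  have hkl' : (k : ℝ) + 1 ≤ l := by exact_mod_cast hkl
  nlinarith

/-- A uniform bound on the entrywise error bounds the error of the sums. -/
theorem abs_sum_sub_sum_le {ι : Type*} [Fintype ι] {f g : ι → ℝ} {ε : ℝ}
    (h : ∀ i, |f i - g i| ≤ ε) : |∑ i, f i - ∑ i, g i| ≤ Fintype.card ι * ε := by
  rw [← Finset.sum_sub_distrib]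
  refine (Finset.abs_sum_le_sum_abs _ _).trans ?_
  simpa using Finset.sum_le_card_nsmul Finset.univ _ ε fun i _ => h i


/-- With `Q` having entries that are integer multiples of `Δmin > 0`
and `|Q' n i − Q n i| ≤ Δ + Δmin/(8N)`, if `a*` maximizes the value under `Q`
and `a` has a strictly smaller value under `Q`, then the `Q'`-value of `a*` exceeds
that of `a` by at least `3Δmin/4 − 2NΔ`; in particular, if `Δ < 3Δmin/(8N)` the
difference is strictly positive. -/
theorem stmt_1 (N K : ℕ) (hN : 0 < N) (hNK : N ≤ K)
    (Δmin : ℝ) (hΔmin : 0 < Δmin)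
    (Q : Fin N → Fin K → ℝ) (hQ : ∀ n i, ∃ m : ℤ, Q n i = m * Δmin)
    (Δ : ℝ) (hΔ0 : 0 ≤ Δ)
    (Q' : Fin N → Fin K → ℝ)
    (hQ' : ∀ n i, |Q' n i - Q n i| ≤ Δ + Δmin / (8 * N))
    (astar : Fin N → Fin K) (hastar : Function.Injective astar)
    (hmax : ∀ b : Fin N → Fin K, Function.Injective b →
      ∑ n, Q n (b n) ≤ ∑ n, Q n (astar n))
    (a : Fin N → Fin K) (ha : Function.Injective a)
    (hlt : ∑ n, Q n (a n) < ∑ n, Q n (astar n)) :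
    3 * Δmin / 4 - 2 * N * Δ ≤ ∑ n, Q' n (astar n) - ∑ n, Q' n (a n) ∧
    (Δ < 3 * Δmin / (8 * N) →
      0 < ∑ n, Q' n (astar n) - ∑ n, Q' n (a n)) := by
  have hN' : (0 : ℝ) < N := by exact_mod_cast hN
  have hcard : (N : ℝ) * (Δ + Δmin / (8 * N)) = N * Δ + Δmin / 8 := by
    field_simp
  have hgap := le_sub_of_lt_of_int_multiples hΔmin
    (sum_int_multiple fun n => hQ n (a n)) (sum_int_multiple fun n => hQ n (astar n)) hlt
  have hpert := abs_sum_sub_sum_le fun n => hQ' n (a n)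
  have hpert_star := abs_sum_sub_sum_le fun n => hQ' n (astar n)
  rw [Fintype.card_fin, hcard, abs_le] at hpert hpert_star
  have hbound : 3 * Δmin / 4 - 2 * N * Δ ≤ ∑ n, Q' n (astar n) - ∑ n, Q' n (a n) := by
    linarith [hpert.2, hpert_star.1]
  refine ⟨hbound, fun hΔ => ?_⟩
  rw [lt_div_iff₀ (by positivity)] at hΔ
  linarith
end
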